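/- (Uniform linear representation, second part) Let Σ₁, Σ₂ ∈ ℝ^{p×p} be symmetric with Λ(k; Σ₂) > 0, Γ₁, Γ₂ ∈ ℝ^p, and let k ≥ 1 be an integer such that RIP(k, Σ₁ − Σ₂) < Λ(k; Σ₂). Then sup_{M∈𝓜(k)} ‖β_M(Σ₁, Γ₁) − β_M(Σ₂, Γ₂) − [Σ₂(M)]^{-1}(Γ₁(M) − Σ₁(M) β_M(Σ₂, Γ₂))‖₂ ≤ (RIP(k, Σ₁ − Σ₂)/Λ(k; Σ₂)) · [𝒟(k, Γ₁ − Γ₂) + RIP(k, Σ₁ − Σ₂) · S_{2,k}(Σ₂, Γ₂)] / [Λ(k; Σ₂) − RIP(k, Σ₁ − Σ₂)]. -/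

import Mathlib

open scoped BigOperators
open MeasureTheory ProbabilityTheory Real Matrix

noncomputable section

/-- The Euclidean (`ℓ₂`) norm of a finitely indexed real vector. -/
def norm2 {ι : Type*} [Fintype ι] (v : ι → ℝ) : ℝ := Real.sqrt (∑ i, (v i) ^ 2)

/-- The `ℓ₁` norm of a finitely indexed real vector. -/
def norm1 {ι : Type*} [Fintype ι] (v : ι → ℝ) : ℝ := ∑ i, |v i|

/-- The `ℓ₂ → ℓ₂` operator norm of a square real matrix. -/
def opNorm {ι : Type*} [Fintype ι] (A : Matrix ι ι ℝ) : ℝ :=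
  sSup {r | ∃ x : ι → ℝ, norm2 x ≤ 1 ∧ r = norm2 (A.mulVec x)}

/-- The collection of models: nonempty subsets of `{1, …, p}` of cardinality at most `k`. -/
def Models (p k : ℕ) : Set (Finset (Fin p)) := {M | 1 ≤ M.card ∧ M.card ≤ k}

/-- The subvector of `v` with indices in the model `M`. -/
def subv {p : ℕ} (v : Fin p → ℝ) (M : Finset (Fin p)) : {x // x ∈ M} → ℝ := fun i => v i.1

/-- The submatrix of `A` with row and column indices in the model `M`. -/
def subm {p : ℕ} (A : Matrix (Fin p) (Fin p) ℝ) (M : Finset (Fin p)) :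
    Matrix {x // x ∈ M} {x // x ∈ M} ℝ := fun i j => A i.1 j.1

/-- `RIP(k, A)`: the maximal `k`-sparse operator norm `sup_{M ∈ 𝓜(k)} ‖A(M)‖_op`. -/
def RIP {p : ℕ} (k : ℕ) (A : Matrix (Fin p) (Fin p) ℝ) : ℝ :=
  ⨆ M : Models p k, opNorm (subm A M.1)

/-- `𝒟(k, v) = sup_{M ∈ 𝓜(k)} ‖v(M)‖₂`. -/
def Dnorm {p : ℕ} (k : ℕ) (v : Fin p → ℝ) : ℝ :=
  ⨆ M : Models p k, norm2 (subv v M.1)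

/-- `θ` has at most `k` nonzero coordinates. -/
def sparse {p : ℕ} (k : ℕ) (θ : Fin p → ℝ) : Prop := Set.ncard {j | θ j ≠ 0} ≤ k

/-- The minimal `k`-sparse eigenvalue
`Λ(k; A) = inf{θᵀAθ/‖θ‖₂² : θ ≠ 0, θ k-sparse}`. -/
def Lam {p : ℕ} (k : ℕ) (A : Matrix (Fin p) (Fin p) ℝ) : ℝ :=
  sInf {r | ∃ θ : Fin p → ℝ, θ ≠ 0 ∧ sparse k θ ∧ r = θ ⬝ᵥ A.mulVec θ / norm2 θ ^ 2}

/-- The linear regression map `β_M(Σ, Γ) = (Σ(M))⁻¹ Γ(M)`. -/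
def betaM {p : ℕ} (M : Finset (Fin p)) (S : Matrix (Fin p) (Fin p) ℝ) (G : Fin p → ℝ) :
    {x // x ∈ M} → ℝ := (subm S M)⁻¹.mulVec (subv G M)

/-- `S_{2,k}(Σ, Γ) = sup_{M ∈ 𝓜(k)} ‖β_M(Σ, Γ)‖₂`. -/
def S2k {p : ℕ} (k : ℕ) (S : Matrix (Fin p) (Fin p) ℝ) (G : Fin p → ℝ) : ℝ :=
  ⨆ M : Models p k, norm2 (betaM M.1 S G)

/-- `S_{1,k}(Σ, Γ) = sup_{M ∈ 𝓜(k)} ‖β_M(Σ, Γ)‖₁`. -/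
def S1k {p : ℕ} (k : ℕ) (S : Matrix (Fin p) (Fin p) ℝ) (G : Fin p → ℝ) : ℝ :=
  ⨆ M : Models p k, norm1 (betaM M.1 S G)

/-- The `k`-sparse Euclidean unit ball `Θ_k ⊆ ℝ^p`. -/
def Theta (p k : ℕ) : Set (Fin p → ℝ) := {θ | sparse k θ ∧ norm2 θ ≤ 1}

/-- The elementwise maximum norm `|||A|||_∞` of a matrix. -/
def normInfMat {p : ℕ} (A : Matrix (Fin p) (Fin p) ℝ) : ℝ :=
  ⨆ q : Fin p × Fin p, |A q.1 q.2|

/-- The supremum norm `‖v‖_∞` of a vector. -/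
def normInfVec {p : ℕ} (v : Fin p → ℝ) : ℝ := ⨆ j, |v j|

lemma norm2_eq {ι : Type*} [Fintype ι] (v : ι → ℝ) : norm2 v = ‖WithLp.toLp 2 v‖ := by
  simp [norm2, EuclideanSpace.norm_eq]

lemma norm2_nonneg {ι : Type*} [Fintype ι] (v : ι → ℝ) : 0 ≤ norm2 v := Real.sqrt_nonneg _

lemma norm2_sq {ι : Type*} [Fintype ι] (v : ι → ℝ) : norm2 v ^ 2 = ∑ i, v i ^ 2 :=
  Real.sq_sqrt (Finset.sum_nonneg fun i _ => sq_nonneg _)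

lemma norm2_smul {ι : Type*} [Fintype ι] (c : ℝ) (v : ι → ℝ) :
    norm2 (c • v) = |c| * norm2 v := by
  rw [norm2_eq, norm2_eq, WithLp.toLp_smul, norm_smul, Real.norm_eq_abs]

lemma norm2_sub_le {ι : Type*} [Fintype ι] (u v : ι → ℝ) :
    norm2 (u - v) ≤ norm2 u + norm2 v := by
  rw [norm2_eq, norm2_eq, norm2_eq, WithLp.toLp_sub]
  exact norm_sub_le _ _

lemma norm2_zero {ι : Type*} [Fintype ι] : norm2 (0 : ι → ℝ) = 0 := by
  simp [norm2]

lemma norm2_eq_zero {ι : Type*} [Fintype ι] {v : ι → ℝ} (h : norm2 v = 0) : v = 0 := by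
  rw [norm2_eq, norm_eq_zero] at h
  simpa using h

lemma dot_le {ι : Type*} [Fintype ι] (u v : ι → ℝ) : u ⬝ᵥ v ≤ norm2 u * norm2 v := by
  have := Real.sum_mul_le_sqrt_mul_sqrt Finset.univ u v
  simpa [dotProduct, norm2] using this

lemma opNorm_bdd {ι : Type*} [Fintype ι] (A : Matrix ι ι ℝ) :
    BddAbove {r | ∃ x : ι → ℝ, norm2 x ≤ 1 ∧ r = norm2 (A.mulVec x)} := by
  classical
  refine ⟨‖Matrix.toEuclideanCLM (𝕜 := ℝ) A‖, ?_⟩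
  rintro r ⟨x, hx, rfl⟩
  have h := (Matrix.toEuclideanCLM (𝕜 := ℝ) A).le_opNorm (WithLp.toLp 2 x)
  rw [Matrix.toEuclideanCLM_toLp, ← norm2_eq, ← norm2_eq] at h
  exact h.trans (mul_le_of_le_one_right (norm_nonneg _) hx)

lemma opNorm_nonneg {ι : Type*} [Fintype ι] (A : Matrix ι ι ℝ) : 0 ≤ opNorm A := by
  apply Real.sSup_nonneg
  rintro r ⟨x, -, rfl⟩
  exact norm2_nonneg _

lemma norm2_mulVec_le {ι : Type*} [Fintype ι] (A : Matrix ι ι ℝ) (x : ι → ℝ) :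
    norm2 (A.mulVec x) ≤ opNorm A * norm2 x := by
  rcases (norm2_nonneg x).eq_or_lt with h | h
  · rw [norm2_eq_zero h.symm]; simp [norm2_zero]
  · have h1 : norm2 (A.mulVec ((norm2 x)⁻¹ • x)) ≤ opNorm A := by
      apply le_csSup (opNorm_bdd A)
      refine ⟨_, ?_, rfl⟩
      rw [norm2_smul, abs_of_pos (inv_pos.2 h), inv_mul_cancel₀ h.ne']
    rw [Matrix.mulVec_smul, norm2_smul, abs_of_pos (inv_pos.2 h), inv_mul_le_iff₀ h] at h1
    linarith

lemma le_sup_models {p k : ℕ} (f : Models p k → ℝ) (M : Models p k) : f M ≤ ⨆ M, f M :=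
  le_ciSup (Set.finite_range f).bddAbove M

lemma lam_quad {p k : ℕ} (A : Matrix (Fin p) (Fin p) ℝ) (hL : 0 < Lam k A)
    (M : Models p k) (x : {x // x ∈ M.1} → ℝ) :
    Lam k A * norm2 x ^ 2 ≤ x ⬝ᵥ (subm A M.1).mulVec x := by
  classical
  by_cases hx : x = 0
  · subst hx; simp [norm2_zero]
  have hb : BddBelow {r | ∃ θ : Fin p → ℝ, θ ≠ 0 ∧ sparse k θ ∧
      r = θ ⬝ᵥ A.mulVec θ / norm2 θ ^ 2} := by
    by_contra h
    have := Real.sInf_of_not_bddBelow h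
    unfold Lam at hL
    linarith
  let θ : Fin p → ℝ := fun j => if h : j ∈ M.1 then x ⟨j, h⟩ else 0
  have hθ : ∀ i : {x // x ∈ M.1}, θ i.1 = x i := fun i => by simp [θ]
  have hθ0 : ∀ j, j ∉ M.1 → θ j = 0 := fun j hj => by simp [θ, hj]
  have hsum : ∀ f : Fin p → ℝ, (∀ j, j ∉ M.1 → f j = 0) →
      ∑ j, f j = ∑ i : {x // x ∈ M.1}, f i.1 := by
    intro f hf
    rw [Finset.sum_coe_sort M.1 f]
    exact (Finset.sum_subset (Finset.subset_univ _) (fun j _ hj => hf j hj)).symm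
  have hne : θ ≠ 0 := by
    intro h
    apply hx
    ext i
    rw [← hθ i, h]; rfl
  have hsp : sparse k θ := by
    refine le_trans ?_ M.2.2
    rw [← Set.ncard_coe_finset]
    refine Set.ncard_le_ncard ?_ (Finset.finite_toSet _)
    intro j hj
    by_contra h
    exact hj (hθ0 j h)
  have hn : norm2 θ ^ 2 = norm2 x ^ 2 := by
    rw [norm2_sq, norm2_sq, hsum _ (fun j hj => by simp [hθ0 j hj])]
    simp [hθ]
  have hq : θ ⬝ᵥ A.mulVec θ = x ⬝ᵥ (subm A M.1).mulVec x := by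
    simp only [dotProduct, Matrix.mulVec, subm]
    rw [hsum _ (fun j hj => by simp [hθ0 j hj])]
    refine Finset.sum_congr rfl fun i _ => ?_
    rw [hsum _ (fun j hj => by simp [hθ0 j hj])]
    simp [hθ]
  have hle : Lam k A ≤ θ ⬝ᵥ A.mulVec θ / norm2 θ ^ 2 := csInf_le hb ⟨θ, hne, hsp, rfl⟩
  have hpos : 0 < norm2 x := lt_of_le_of_ne (norm2_nonneg x) fun h => hx (norm2_eq_zero h.symm)
  rw [hn, hq, le_div_iff₀ (by positivity)] at hle
  exact hle

lemma lam_lower {p k : ℕ} (A : Matrix (Fin p) (Fin p) ℝ) (hL : 0 < Lam k A)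
    (M : Models p k) (x : {x // x ∈ M.1} → ℝ) :
    Lam k A * norm2 x ≤ norm2 ((subm A M.1).mulVec x) := by
  have h1 := lam_quad A hL M x
  have h2 := dot_le x ((subm A M.1).mulVec x)
  rcases (norm2_nonneg x).eq_or_lt with h | h
  · rw [← h]; simpa using norm2_nonneg _
  · nlinarith

lemma isUnit_det_of_lower {ι : Type*} [Fintype ι] [DecidableEq ι] (A : Matrix ι ι ℝ) (c : ℝ)
    (hc : 0 < c) (h : ∀ x, c * norm2 x ≤ norm2 (A.mulVec x)) : IsUnit A.det := by
  rw [← Matrix.isUnit_iff_isUnit_det, ← Matrix.mulVec_injective_iff_isUnit]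
  intro x y hxy
  have h1 := h (x - y)
  rw [Matrix.mulVec_sub, hxy, sub_self, norm2_zero] at h1
  have h2 := norm2_nonneg (x - y)
  exact sub_eq_zero.1 (norm2_eq_zero (by nlinarith))

/-- Uniform linear representation, second part: if
`RIP(k, Σ₁ − Σ₂) < Λ(k; Σ₂)` then
`sup_{M∈𝓜(k)} ‖β_M(Σ₁,Γ₁) − β_M(Σ₂,Γ₂) − (Σ₂(M))⁻¹(Γ₁(M) − Σ₁(M)β_M(Σ₂,Γ₂))‖₂
 ≤ (RIP/Λ) · (𝒟(k,Γ₁−Γ₂) + RIP·S_{2,k}(Σ₂,Γ₂)) / (Λ − RIP)`. -/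
theorem stmt7 {p : ℕ} (k : ℕ) (hk : 1 ≤ k)
    (Sig1 Sig2 : Matrix (Fin p) (Fin p) ℝ) (hS1 : Sig1.IsSymm) (hS2 : Sig2.IsSymm)
    (G1 G2 : Fin p → ℝ)
    (hLam : 0 < Lam k Sig2)
    (hRIP : RIP k (Sig1 - Sig2) < Lam k Sig2) :
    (⨆ M : Models p k,
        norm2 (betaM M.1 Sig1 G1 - betaM M.1 Sig2 G2
          - (subm Sig2 M.1)⁻¹.mulVec
              (subv G1 M.1 - (subm Sig1 M.1).mulVec (betaM M.1 Sig2 G2)))) ≤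
      (RIP k (Sig1 - Sig2) / Lam k Sig2) *
        ((Dnorm k (G1 - G2) + RIP k (Sig1 - Sig2) * S2k k Sig2 G2) /
          (Lam k Sig2 - RIP k (Sig1 - Sig2))) := by
  have hR0 : 0 ≤ RIP k (Sig1 - Sig2) := Real.iSup_nonneg fun M => opNorm_nonneg _
  have hD0 : 0 ≤ Dnorm k (G1 - G2) := Real.iSup_nonneg fun M => norm2_nonneg _
  have hS0 : 0 ≤ S2k k Sig2 G2 := Real.iSup_nonneg fun M => norm2_nonneg _
  have hpos : 0 < Lam k Sig2 - RIP k (Sig1 - Sig2) := by linarith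
  refine Real.iSup_le (fun M => ?_) (by positivity)
  have hR : ∀ x, norm2 ((subm (Sig1 - Sig2) M.1).mulVec x) ≤ RIP k (Sig1 - Sig2) * norm2 x :=
    fun x => (norm2_mulVec_le _ x).trans (mul_le_mul_of_nonneg_right
      (le_sup_models (fun M : Models p k => opNorm (subm (Sig1 - Sig2) M.1)) M) (norm2_nonneg x))
  have hD : norm2 (subv (G1 - G2) M.1) ≤ Dnorm k (G1 - G2) :=
    le_sup_models (fun M : Models p k => norm2 (subv (G1 - G2) M.1)) M
  have hS : norm2 (betaM M.1 Sig2 G2) ≤ S2k k Sig2 G2 :=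
    le_sup_models (fun M : Models p k => norm2 (betaM M.1 Sig2 G2)) M
  have hl2 := lam_lower Sig2 hLam M
  have hsub : subm (Sig1 - Sig2) M.1 = subm Sig1 M.1 - subm Sig2 M.1 := rfl
  have hsubv : subv (G1 - G2) M.1 = subv G1 M.1 - subv G2 M.1 := rfl
  have hl1 : ∀ x, (Lam k Sig2 - RIP k (Sig1 - Sig2)) * norm2 x ≤
      norm2 ((subm Sig1 M.1).mulVec x) := by
    intro x
    have h1 := hl2 x
    have h2 := hR x
    have h3 := norm2_sub_le ((subm Sig1 M.1).mulVec x) ((subm (Sig1 - Sig2) M.1).mulVec x)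
    rw [hsub, Matrix.sub_mulVec, sub_sub_cancel, ← Matrix.sub_mulVec, ← hsub] at h3
    linarith
  have hu2 := isUnit_det_of_lower _ _ hLam hl2
  have hu1 := isUnit_det_of_lower _ _ hpos hl1
  have hb1 : (subm Sig1 M.1).mulVec (betaM M.1 Sig1 G1) = subv G1 M.1 := by
    rw [betaM, Matrix.mulVec_mulVec, Matrix.mul_nonsing_inv _ hu1, Matrix.one_mulVec]
  have hb2 : (subm Sig2 M.1).mulVec (betaM M.1 Sig2 G2) = subv G2 M.1 := by
    rw [betaM, Matrix.mulVec_mulVec, Matrix.mul_nonsing_inv _ hu2, Matrix.one_mulVec]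
  generalize betaM M.1 Sig1 G1 = b1 at *
  generalize betaM M.1 Sig2 G2 = b2 at *
  have hw : norm2 (b1 - b2) ≤ (Dnorm k (G1 - G2) + RIP k (Sig1 - Sig2) * S2k k Sig2 G2) /
      (Lam k Sig2 - RIP k (Sig1 - Sig2)) := by
    rw [le_div_iff₀ hpos]
    have h1 := hl1 (b1 - b2)
    have h2 : (subm Sig1 M.1).mulVec (b1 - b2) =
        subv (G1 - G2) M.1 - (subm (Sig1 - Sig2) M.1).mulVec b2 := by
      rw [Matrix.mulVec_sub, hb1, hsub, hsubv, Matrix.sub_mulVec, hb2]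
      abel
    have h3 := norm2_sub_le (subv (G1 - G2) M.1) ((subm (Sig1 - Sig2) M.1).mulVec b2)
    rw [← h2] at h3
    have h4 := hR b2
    have h5 := mul_le_mul_of_nonneg_left hS hR0
    linarith
  have he := hl2 (b1 - b2 - (subm Sig2 M.1)⁻¹.mulVec (subv G1 M.1 - (subm Sig1 M.1).mulVec b2))
  have he2 : (subm Sig2 M.1).mulVec
      (b1 - b2 - (subm Sig2 M.1)⁻¹.mulVec (subv G1 M.1 - (subm Sig1 M.1).mulVec b2)) =
      (subm (Sig1 - Sig2) M.1).mulVec (b2 - b1) := by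
    rw [Matrix.mulVec_sub, Matrix.mulVec_mulVec, Matrix.mul_nonsing_inv _ hu2,
      Matrix.one_mulVec, ← hb1, hsub, Matrix.sub_mulVec]
    simp only [Matrix.mulVec_sub]
    abel
  have hsw : norm2 (b2 - b1) = norm2 (b1 - b2) := by
    rw [norm2_eq, norm2_eq, WithLp.toLp_sub, WithLp.toLp_sub, norm_sub_rev]
  rw [he2] at he
  have h6 := hR (b2 - b1)
  rw [hsw] at h6
  have h7 := mul_le_mul_of_nonneg_left hw hR0
  rw [div_mul_eq_mul_div, le_div_iff₀ hLam]
  linarith
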